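/- arXiv:1210.0075 — 6 statements merged into one kernel-verified Lean document; each statement's English description precedes it below -/
import Mathlib

section
/- Let C = {K_1, …, K_m} be a covering of a finite set E and M(C) the transversal matroid of C. Then M(C) is a simple matroid (it has no loops and no pair of parallel elements) if and only if |A_i| = 1 for every 1 ≤ i ≤ s. -/
variable {α : Type*}

/-- `C` is a covering of the (finite) universe: a finite family of nonempty
subsets whose union is everything. -/
def IsCovering [Fintype α] (C : Finset (Set α)) : Prop :=
  (∀ K ∈ C, K.Nonempty) ∧ ⋃₀ (C : Set (Set α)) = Set.univ

/-- `X` is a partial transversal of the family `C` of subsets of `α`: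
there is an injective choice of a member of `C` containing each point of `X`. -/
def IsPartialTransversal (C : Finset (Set α)) (X : Set α) : Prop :=
  ∃ f : α → Set α, Set.InjOn f X ∧ ∀ x ∈ X, f x ∈ C ∧ x ∈ f x

/-- The collection `A = {A_1, …, A_s}`: the nonempty sets of the form
`K \ ⋃ (C - {K})` for `K ∈ C`. -/
def coreBlocks (C : Finset (Set α)) : Set (Set α) :=
  {S | ∃ K ∈ C, S = K \ ⋃₀ ((C : Set (Set α)) \ {K}) ∧ S.Nonempty}

/-- The set `B = E \ (A_1 ∪ ⋯ ∪ A_s)`. -/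
def residue [Fintype α] (C : Finset (Set α)) : Set α :=
  Set.univ \ ⋃₀ coreBlocks C

theorem isPartialTransversal_singleton_iff {C : Finset (Set α)} {x : α} :
    IsPartialTransversal C {x} ↔ ∃ K ∈ C, x ∈ K := by
  constructor
  · rintro ⟨f, -, hf⟩
    exact ⟨f x, hf x rfl⟩
  · rintro ⟨K, hK, hx⟩
    refine ⟨fun _ => K, Set.injOn_singleton _ _, ?_⟩
    rintro _ rfl
    exact ⟨hK, hx⟩

theorem isPartialTransversal_pair_iff {C : Finset (Set α)} {x y : α} (hxy : x ≠ y) :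
    IsPartialTransversal C {x, y} ↔ ∃ K ∈ C, ∃ L ∈ C, K ≠ L ∧ x ∈ K ∧ y ∈ L := by
  classical
  constructor
  · rintro ⟨f, hinj, hf⟩
    have hx := hf x (by simp)
    have hy := hf y (by simp)
    exact ⟨f x, hx.1, f y, hy.1, fun h => hxy (hinj (by simp) (by simp) h), hx.2, hy.2⟩
  · rintro ⟨K, hK, L, hL, hne, hx, hy⟩
    refine ⟨fun z => if z = x then K else L, ?_, ?_⟩
    · rintro a (rfl | rfl) b (rfl | rfl) h <;> simp_all [hxy.symm]
    · rintro a (rfl | rfl)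
      · simp [hK, hx]
      · simp [hxy.symm, hL, hy]

theorem mem_diff_sUnion_diff_singleton_iff {C : Set (Set α)} {K : Set α} {x : α} :
    x ∈ K \ ⋃₀ (C \ {K}) ↔ x ∈ K ∧ ∀ L ∈ C, x ∈ L → L = K := by
  simp only [Set.mem_sdiff, Set.mem_sUnion, Set.mem_singleton_iff, not_exists, not_and]
  grind

/-- for a covering `C` of a finite set `E` and `M` the transversal
matroid of `C`, `M` is simple (no loops: every singleton is independent; and no
parallel pairs: no two distinct independent singletons form a dependent pair)
iff `|A_i| = 1` for every `i`. -/
theorem stmt5 [Fintype α] (C : Finset (Set α)) (hC : IsCovering C)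
    (M : Matroid α) (hE : M.E = Set.univ)
    (hInd : ∀ X : Set α, M.Indep X ↔ IsPartialTransversal C X) :
    ((∀ x : α, M.Indep {x}) ∧
      (∀ x y : α, x ≠ y → M.Indep {x} → M.Indep {y} → M.Indep {x, y})) ↔
      ∀ S ∈ coreBlocks C, S.ncard = 1 := by
  simp only [hInd]
  constructor
  · rintro ⟨hloop, hpar⟩ S ⟨K, -, rfl, x, hx⟩
    rw [Set.ncard_eq_one]
    refine ⟨x, Set.eq_singleton_iff_unique_mem.2 ⟨hx, fun y hy => ?_⟩⟩
    by_contra hyx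
    obtain ⟨L, hL, L', hL', hne, hyL, hxL'⟩ :=
      (isPartialTransversal_pair_iff hyx).1 (hpar y x hyx (hloop y) (hloop x))
    rw [mem_diff_sUnion_diff_singleton_iff] at hx hy
    exact hne ((hy.2 L hL hyL).trans (hx.2 L' hL' hxL').symm)
  · intro h
    refine ⟨fun x => isPartialTransversal_singleton_iff.2 ?_, fun x y hxy hx hy => ?_⟩
    · have hx : x ∈ ⋃₀ (C : Set (Set α)) := hC.2 ▸ Set.mem_univ x
      exact hx
    · obtain ⟨K, hK, hxK⟩ := isPartialTransversal_singleton_iff.1 hx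
      obtain ⟨L, hL, hyL⟩ := isPartialTransversal_singleton_iff.1 hy
      rw [isPartialTransversal_pair_iff hxy]
      by_contra! hcon
      have hxcore : x ∈ K \ ⋃₀ ((C : Set (Set α)) \ {K}) :=
        mem_diff_sUnion_diff_singleton_iff.2 ⟨hxK, by grind⟩
      have hycore : y ∈ K \ ⋃₀ ((C : Set (Set α)) \ {K}) :=
        mem_diff_sUnion_diff_singleton_iff.2 ⟨by grind, by grind⟩
      obtain ⟨z, hz⟩ := Set.ncard_eq_one.1 (h _ ⟨K, hK, rfl, x, hxcore⟩)
      rw [hz] at hxcore hycore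
      exact hxy (hxcore.trans hycore.symm)
end

section
/- Let C be a covering of a finite set E. For all X ⊆ E and all x, y ∈ E: if y ∈ SH(X ∪ {x}) \ SH(X), then x ∈ SH(X ∪ {y}). -/
variable {α : Type*}

/-- The second covering upper approximation operator:
`SH(X) = ⋃ {K ∈ C : K ∩ X ≠ ∅}`. -/
def SH (C : Finset (Set α)) (X : Set α) : Set α :=
  ⋃₀ {K | K ∈ C ∧ (K ∩ X).Nonempty}

/-- for a covering `C` of a finite set `E`, for all `X ⊆ E` and
`x, y ∈ E`: if `y ∈ SH(X ∪ {x}) \ SH(X)`, then `x ∈ SH(X ∪ {y})`. -/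
theorem stmt10 [Fintype α] (C : Finset (Set α)) (hC : IsCovering C) :
    ∀ X : Set α, ∀ x y : α,
      y ∈ SH C (X ∪ {x}) \ SH C X → x ∈ SH C (X ∪ {y}) := by
  rintro X x y ⟨⟨K, ⟨hK, z, hzK, hz⟩, hyK⟩, hy⟩
  rcases hz with hzX | rfl
  · exact absurd ⟨K, ⟨hK, z, hzK, hzX⟩, hyK⟩ hy
  · exact ⟨K, ⟨hK, y, hyK, Or.inr rfl⟩, hzK⟩
end

section
/- Let C be a covering of a finite set E. Then SH(SH(X)) = SH(X) for all X ⊆ E if and only if the family {I(x) : x ∈ E} forms a partition of E, i.e. for all x, y ∈ E, either I(x) = I(y) or I(x) ∩ I(y) = ∅. -/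
variable {α : Type*}

/-- The indiscernible neighborhood of `x`: `I(x) = ⋃ {K ∈ C : x ∈ K}`. -/
def indNbhd (C : Finset (Set α)) (x : α) : Set α :=
  ⋃₀ {K | K ∈ C ∧ x ∈ K}

theorem mem_indNbhd {C : Finset (Set α)} {x y : α} :
    y ∈ indNbhd C x ↔ ∃ K ∈ C, x ∈ K ∧ y ∈ K := by
  simp [indNbhd, and_assoc]

theorem mem_indNbhd_comm {C : Finset (Set α)} {x y : α} :
    y ∈ indNbhd C x ↔ x ∈ indNbhd C y := by
  simp only [mem_indNbhd, and_comm]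

theorem mem_SH {C : Finset (Set α)} {X : Set α} {y : α} :
    y ∈ SH C X ↔ ∃ x ∈ X, y ∈ indNbhd C x := by
  simp only [mem_indNbhd]
  constructor
  · rintro ⟨K, ⟨hK, x, hxK, hx⟩, hy⟩
    exact ⟨x, hx, K, hK, hxK, hy⟩
  · rintro ⟨x, hx, K, hK, hxK, hy⟩
    exact ⟨K, ⟨hK, x, hxK, hx⟩, hy⟩

theorem IsCovering.mem_indNbhd_self [Fintype α] {C : Finset (Set α)} (hC : IsCovering C) (x : α) :
    x ∈ indNbhd C x := by
  obtain ⟨K, hK, hx⟩ : x ∈ ⋃₀ (C : Set (Set α)) := hC.2 ▸ Set.mem_univ x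
  exact mem_indNbhd.2 ⟨K, hK, hx, hx⟩

/-- for a covering `C` of a finite set `E`, `SH(SH(X)) = SH(X)`
for all `X ⊆ E` iff the family `{I(x) : x ∈ E}` forms a partition of `E`. -/
theorem stmt11 [Fintype α] (C : Finset (Set α)) (hC : IsCovering C) :
    (∀ X : Set α, SH C (SH C X) = SH C X) ↔
      ∀ x y : α, indNbhd C x = indNbhd C y ∨ indNbhd C x ∩ indNbhd C y = ∅ := by
  constructor
  · intro h
    have trans {x y z : α} (hxy : y ∈ indNbhd C x) (hyz : z ∈ indNbhd C y) :
        z ∈ indNbhd C x := by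
      have hz : z ∈ SH C (SH C {x}) := mem_SH.2 ⟨y, mem_SH.2 ⟨x, rfl, hxy⟩, hyz⟩
      rw [h] at hz
      obtain ⟨_, rfl, hxz⟩ := mem_SH.1 hz
      exact hxz
    intro x y
    refine (Set.eq_empty_or_nonempty (indNbhd C x ∩ indNbhd C y)).symm.imp_left ?_
    rintro ⟨z, hzx, hzy⟩
    have hxy : y ∈ indNbhd C x := trans hzx (mem_indNbhd_comm.1 hzy)
    exact Set.Subset.antisymm (fun _ hw => trans (mem_indNbhd_comm.1 hxy) hw)
      (fun _ hw => trans hxy hw)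
  · intro h X
    ext z
    constructor
    · intro hz
      obtain ⟨y, hy, hzy⟩ := mem_SH.1 hz
      obtain ⟨x, hx, hyx⟩ := mem_SH.1 hy
      refine mem_SH.2 ⟨x, hx, ?_⟩
      rcases h x y with hxy | hxy
      · rwa [hxy]
      · exact (Set.eq_empty_iff_forall_notMem.1 hxy y ⟨hyx, hC.mem_indNbhd_self y⟩).elim
    · exact fun hz => mem_SH.2 ⟨z, hz, hC.mem_indNbhd_self z⟩
end

section
/- Let C be a covering of a finite set E such that the family {I(x) : x ∈ E} forms a partition of E. Then the family of sets I_SH(C) = {I ⊆ E : for all x ∈ I, x ∉ SH(I \ {x})} coincides with {I ⊆ E : |I ∩ I(x)| ≤ 1 for every x ∈ E}, and this family is the collection of independent sets of a matroid on E. -/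
variable {α : Type*}

theorem mem_SH_iff (C : Finset (Set α)) (X : Set α) (x : α) :
    x ∈ SH C X ↔ ∃ y ∈ X, x ∈ indNbhd C y := by
  constructor
  · rintro ⟨K, ⟨hK, y, hyK, hyX⟩, hxK⟩
    exact ⟨y, hyX, K, ⟨hK, hyK⟩, hxK⟩
  · rintro ⟨y, hyX, K, ⟨hK, hyK⟩, hxK⟩
    exact ⟨K, ⟨hK, y, hyK, hyX⟩, hxK⟩

theorem IsCovering.mem_indNbhd_iff [Fintype α] {C : Finset (Set α)} (hC : IsCovering C)
    (hpart : ∀ x y : α, indNbhd C x = indNbhd C y ∨ indNbhd C x ∩ indNbhd C y = ∅)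
    (x y : α) : x ∈ indNbhd C y ↔ indNbhd C x = indNbhd C y := by
  refine ⟨fun h ↦ (hpart x y).resolve_right fun he ↦ ?_, fun h ↦ h ▸ hC.mem_indNbhd_self x⟩
  exact Set.notMem_empty x (he ▸ ⟨hC.mem_indNbhd_self x, h⟩)

theorem IsCovering.forall_ncard_inter_indNbhd_le_one_iff [Fintype α] {C : Finset (Set α)}
    (hC : IsCovering C)
    (hpart : ∀ x y : α, indNbhd C x = indNbhd C y ∨ indNbhd C x ∩ indNbhd C y = ∅)
    (I : Set α) :
    (∀ x, (I ∩ indNbhd C x).ncard ≤ 1) ↔ Set.InjOn (indNbhd C) I := by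
  simp only [Set.ncard_le_one (Set.toFinite _), Set.mem_inter_iff, hC.mem_indNbhd_iff hpart]
  exact ⟨fun h a ha b hb hab ↦ h b a ⟨ha, hab⟩ b ⟨hb, rfl⟩,
    fun h x a ha b hb ↦ h ha.1 hb.1 (ha.2.trans hb.2.symm)⟩

theorem IsCovering.forall_notMem_SH_diff_singleton_iff [Fintype α] {C : Finset (Set α)}
    (hC : IsCovering C)
    (hpart : ∀ x y : α, indNbhd C x = indNbhd C y ∨ indNbhd C x ∩ indNbhd C y = ∅)
    (I : Set α) :
    (∀ x ∈ I, x ∉ SH C (I \ {x})) ↔ Set.InjOn (indNbhd C) I := by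
  simp only [mem_SH_iff, hC.mem_indNbhd_iff hpart]
  constructor
  · intro h a ha b hb hab
    by_contra hne
    exact h a ha ⟨b, ⟨hb, Ne.symm hne⟩, hab⟩
  · rintro h a ha ⟨b, ⟨hb, hne⟩, hab⟩
    exact hne (h ha hb hab).symm

/-- On a finite type, the sets on which a function is injective are the independent sets of a
matroid. -/
theorem exists_matroid_indep_iff_injOn [Finite α] {β : Type*} (f : α → β) :
    ∃ M : Matroid α, M.E = Set.univ ∧ ∀ I : Set α, M.Indep I ↔ Set.InjOn f I := by
  refine ⟨(IndepMatroid.ofFinite (E := Set.univ) Set.finite_univ (fun I ↦ Set.InjOn f I)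
    (Set.injOn_empty f) (fun _ _ hJ hIJ ↦ hJ.mono hIJ) ?_
    fun _ _ ↦ Set.subset_univ _).matroid, rfl, fun _ ↦ Iff.rfl⟩
  intro I J hI hJ hIJ
  rw [← hI.ncard_image, ← hJ.ncard_image] at hIJ
  obtain ⟨_, ⟨e, he, rfl⟩, hnot⟩ := Set.exists_mem_notMem_of_ncard_lt_ncard hIJ
  have heI : e ∉ I := fun h ↦ hnot (Set.mem_image_of_mem f h)
  exact ⟨e, he, heI, (Set.injOn_insert heI).2 ⟨hI, hnot⟩⟩

/-- for a covering `C` of a finite set `E` such that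
`{I(x) : x ∈ E}` is a partition of `E`, the family
`{I ⊆ E : ∀ x ∈ I, x ∉ SH(I \ {x})}` coincides with
`{I ⊆ E : |I ∩ I(x)| ≤ 1 for all x}`, and this family is the collection of
independent sets of a matroid on `E`. -/
theorem stmt13 [Fintype α] (C : Finset (Set α)) (hC : IsCovering C)
    (hpart : ∀ x y : α,
      indNbhd C x = indNbhd C y ∨ indNbhd C x ∩ indNbhd C y = ∅) :
    ({I : Set α | ∀ x ∈ I, x ∉ SH C (I \ {x})} =
      {I : Set α | ∀ x : α, (I ∩ indNbhd C x).ncard ≤ 1}) ∧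
    (∃ M : Matroid α, M.E = Set.univ ∧
      ∀ I : Set α, M.Indep I ↔ ∀ x : α, (I ∩ indNbhd C x).ncard ≤ 1) := by
  simp only [hC.forall_ncard_inter_indNbhd_le_one_iff hpart,
    hC.forall_notMem_SH_diff_singleton_iff hpart]
  exact ⟨trivial, exists_matroid_indep_iff_injOn (indNbhd C)⟩
end

section
/- Let C be a covering of a finite set E. There exists a matroid M on E whose closure operator equals XH (i.e. cl_M(X) = XH(X) for all X ⊆ E) if and only if the family {N(x) : x ∈ E} forms a partition of E, i.e. for all x, y ∈ E, either N(x) = N(y) or N(x) ∩ N(y) = ∅. -/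
variable {α : Type*}

/-- The neighborhood of `x`: `N(x) = ⋂ {K ∈ C : x ∈ K}`. -/
def nbhd (C : Finset (Set α)) (x : α) : Set α :=
  ⋂₀ {K | K ∈ C ∧ x ∈ K}

/-- The sixth covering upper approximation operator:
`XH(X) = {x : N(x) ∩ X ≠ ∅}`. -/
def XH (C : Finset (Set α)) (X : Set α) : Set α :=
  {x | (nbhd C x ∩ X).Nonempty}

lemma mem_nbhd_self (C : Finset (Set α)) (x : α) : x ∈ nbhd C x :=
  fun _ hK ↦ hK.2

lemma nbhd_subset_of_mem {C : Finset (Set α)} {x y : α} (h : y ∈ nbhd C x) :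
    nbhd C y ⊆ nbhd C x :=
  fun _ hz K hK ↦ hz K ⟨hK.1, h K hK⟩

lemma mem_XH_singleton {C : Finset (Set α)} {x y : α} : x ∈ XH C {y} ↔ y ∈ nbhd C x := by
  simp [XH]

lemma XH_eq_preimage_image {C : Finset (Set α)}
    (h : ∀ x y : α, nbhd C x = nbhd C y ∨ nbhd C x ∩ nbhd C y = ∅) (X : Set α) :
    XH C X = nbhd C ⁻¹' (nbhd C '' X) := by
  ext x
  constructor
  · rintro ⟨y, hyx, hyX⟩
    refine ⟨y, hyX, (h y x).resolve_right fun he ↦ ?_⟩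
    exact Set.notMem_empty y (he ▸ ⟨mem_nbhd_self C y, hyx⟩)
  · rintro ⟨y, hyX, hyx⟩
    exact ⟨y, hyx ▸ mem_nbhd_self C y, hyX⟩

lemma mem_nbhd_symm_of_closure_eq {C : Finset (Set α)} {M : Matroid α}
    (hM : ∀ X : Set α, M.closure X = XH C X) {x z : α} (h : z ∈ nbhd C x) : x ∈ nbhd C z := by
  have hx : x ∈ M.closure (insert z ∅) \ M.closure ∅ := by
    refine ⟨?_, ?_⟩
    · simpa [hM, mem_XH_singleton] using h
    · simp [hM, XH]
  simpa [hM, mem_XH_singleton] using (M.closure_exchange hx).1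

/-- for a covering `C` of a finite set `E`, there is a matroid
`M` on `E` whose closure operator is `XH` iff the family `{N(x) : x ∈ E}`
forms a partition of `E`. -/
theorem stmt16 [Fintype α] (C : Finset (Set α)) (hC : IsCovering C) :
    (∃ M : Matroid α, M.E = Set.univ ∧ ∀ X : Set α, M.closure X = XH C X) ↔
      ∀ x y : α, nbhd C x = nbhd C y ∨ nbhd C x ∩ nbhd C y = ∅ := by
  constructor
  · rintro ⟨M, -, hM⟩ x y
    refine (Set.eq_empty_or_nonempty (nbhd C x ∩ nbhd C y)).symm.imp_left ?_
    rintro ⟨z, hzx, hzy⟩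
    have eq_of_mem {w : α} (hw : z ∈ nbhd C w) : nbhd C w = nbhd C z :=
      (nbhd_subset_of_mem (mem_nbhd_symm_of_closure_eq hM hw)).antisymm (nbhd_subset_of_mem hw)
    rw [eq_of_mem hzx, eq_of_mem hzy]
  · intro h
    refine ⟨(Matroid.freeOn Set.univ).comap (nbhd C), by simp, fun X ↦ ?_⟩
    rw [XH_eq_preimage_image h, Matroid.comap_closure_eq]
    simp
end

section
/- Let C be a covering of a finite set E such that the family {I(x) : x ∈ E} forms a partition of E, and let M(C) be the transversal matroid of C. Then: (1) every set I ⊆ E satisfying (for all x ∈ I, x ∉ SH(I \ {x})) is a partial transversal of C, i.e. independent in M(C); and (2) every set X ⊆ E with SH(X) = X is a flat of M(C), i.e. cl_{M(C)}(X) = X. -/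
variable {α : Type*}

theorem IsCovering.exists_mem [Fintype α] {C : Finset (Set α)} (hC : IsCovering C) (x : α) :
    ∃ K ∈ C, x ∈ K := by
  have hx : x ∈ ⋃₀ (C : Set (Set α)) := hC.2 ▸ Set.mem_univ x
  simpa using hx

theorem IsCovering.isPartialTransversal_of_notMem_SH [Fintype α] {C : Finset (Set α)}
    (hC : IsCovering C) {I : Set α} (hI : ∀ x ∈ I, x ∉ SH C (I \ {x})) :
    IsPartialTransversal C I := by
  choose f hfC hf using hC.exists_mem
  refine ⟨f, fun x hx y hy hxy => ?_, fun x _ => ⟨hfC x, hf x⟩⟩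
  by_contra hne
  exact hI x hx ⟨f x, ⟨hfC x, y, hxy ▸ hf y, hy, Ne.symm hne⟩, hf x⟩

/-- A partial transversal contained in an `SH`-closed set `X` extends by any point outside `X`. -/
theorem IsPartialTransversal.insert_of_SH_eq [Fintype α] {C : Finset (Set α)}
    (hC : IsCovering C) {X B : Set α} (hX : SH C X = X) (hBX : B ⊆ X)
    (hB : IsPartialTransversal C B) {e : α} (he : e ∉ X) :
    IsPartialTransversal C (insert e B) := by
  classical
  obtain ⟨f, hf, hfB⟩ := hB
  obtain ⟨K, hK, heK⟩ := hC.exists_mem e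
  have heB : e ∉ B := fun h => he (hBX h)
  have hne {b : α} (hb : b ∈ B) : b ≠ e := fun h => heB (h ▸ hb)
  refine ⟨Function.update f e K, (Set.injOn_insert heB).2 ⟨fun x hx y hy hxy => ?_, ?_⟩, ?_⟩
  · rw [Function.update_of_ne (hne hx), Function.update_of_ne (hne hy)] at hxy
    exact hf hx hy hxy
  · rintro ⟨b, hb, hbK⟩
    rw [Function.update_of_ne (hne hb), Function.update_self] at hbK
    exact he (hX ▸ ⟨K, ⟨hK, b, hbK ▸ (hfB b hb).2, hBX hb⟩, heK⟩)
  · rintro x (rfl | hx)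
    · simpa using ⟨hK, heK⟩
    · rw [Function.update_of_ne (hne hx)]
      exact hfB x hx

/-- for a covering `C` of a finite set `E` such that
`{I(x) : x ∈ E}` is a partition of `E`, and `M` the transversal matroid of `C`:
(1) every `I ⊆ E` with `x ∉ SH(I \ {x})` for all `x ∈ I` is independent in
`M`; and (2) every `X ⊆ E` with `SH(X) = X` is a flat of `M`. -/
theorem stmt19 [Fintype α] (C : Finset (Set α)) (hC : IsCovering C)
    (hpart : ∀ x y : α,
      indNbhd C x = indNbhd C y ∨ indNbhd C x ∩ indNbhd C y = ∅)
    (M : Matroid α) (hE : M.E = Set.univ)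
    (hInd : ∀ X : Set α, M.Indep X ↔ IsPartialTransversal C X) :
    (∀ I : Set α, (∀ x ∈ I, x ∉ SH C (I \ {x})) → M.Indep I) ∧
    (∀ X : Set α, SH C X = X → M.closure X = X) := by
  refine ⟨fun I hI => (hInd I).2 (hC.isPartialTransversal_of_notMem_SH hI), fun X hX => ?_⟩
  have hXE : X ⊆ M.E := hE ▸ Set.subset_univ X
  refine subset_antisymm (fun e he => ?_) (M.subset_closure X hXE)
  by_contra heX
  obtain ⟨B, hB⟩ := M.exists_isBasis X hXE
  have hins : M.Indep (insert e B) :=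
    (hInd _).2 (((hInd B).1 hB.indep).insert_of_SH_eq hC hX hB.subset heX)
  rw [← hB.closure_eq_closure, hB.indep.mem_closure_iff] at he
  rcases he with hdep | heB
  · exact hdep.not_indep hins
  · exact heX (hB.subset heB)
end
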